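/- Coupling the truncated and full inverted processes. Let H be a 2-balanced graph and set m = ⌈n^{2−1/d_2(H)}(log n)²⌉. There is a coupling of the processes such that, for every c > 0, there exists n_0 = n_0(c,H) so that for all n ≥ n_0, with probability at least 1 − n^{−c} one has G_{n,m}(H) = G_{n,\binom{n}{2}}(H) = G_{n,1}(H); in particular, considering only the first m edges of a uniformly random edge ordering almost surely already yields the final graph of the full process. -/

import Mathlib

open scoped ENNReal

noncomputable def prOf {α : Type*} (μ : PMF α) (E : Set α) : ℝ≥0∞ :=
  ∑' x : E, μ x

/-- `d_2(H) = (e_H - 1)/(v_H - 2)`. -/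
noncomputable def d2 {β : Type*} [Fintype β] (H : SimpleGraph β) : ℝ :=
  ((H.edgeSet.ncard : ℝ) - 1) / ((Fintype.card β : ℝ) - 2)

/-- `H` is 2-balanced: `e_H ≥ 2` and every proper subgraph `G ⊊ H` with at least 3
vertices satisfies `(e_G - 1)/(v_G - 2) ≤ d_2(H)`. -/
def TwoBalanced {β : Type*} [Fintype β] (H : SimpleGraph β) : Prop :=
  2 ≤ H.edgeSet.ncard ∧
    ∀ G : H.Subgraph, G ≠ ⊤ → 3 ≤ G.verts.ncard →
      ((G.edgeSet.ncard : ℝ) - 1) / ((G.verts.ncard : ℝ) - 2) ≤ d2 H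

/-- `m_2(H)`: the maximum of `d_2(G)` over all subgraphs `G ⊆ H` with at least one edge,
where a subgraph with exactly one edge (a copy of `K_2`) has `d_2 = 1/2`. -/
noncomputable def m2 {β : Type*} [Fintype β] (H : SimpleGraph β) : ℝ :=
  sSup {x : ℝ | ∃ G : H.Subgraph, 1 ≤ G.edgeSet.ncard ∧
    x = if G.edgeSet.ncard = 1 then 1 / 2
        else ((G.edgeSet.ncard : ℝ) - 1) / ((G.verts.ncard : ℝ) - 2)}

/-- The edge set `E` contains a copy of `H` using the edge `e`. -/
def copyAt {β V : Type*} (H : SimpleGraph β) (E : Set (Sym2 V)) (e : Sym2 V) : Prop :=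
  ∃ φ : β ↪ V, (∀ a b, H.Adj a b → s(φ a, φ b) ∈ E) ∧ ∃ a b, H.Adj a b ∧ e = s(φ a, φ b)

/-- The edges of the complete graph `K_n` on `Fin n`. -/
abbrev EdgeType (n : ℕ) := {e : Sym2 (Fin n) // ¬ e.IsDiag}

/-- A uniformly random ordering of the edges of `K_n` is a uniformly random bijection
from the edges to `Fin (number of edges)`. -/
abbrev EdgeOrder (n : ℕ) := EdgeType n ≃ Fin (Fintype.card (EdgeType n))

/-- The uniform distribution on orderings of the edges of `K_n`. -/
noncomputable def ordPMF (n : ℕ) : PMF (EdgeOrder n) :=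
  haveI : Nonempty (EdgeOrder n) := ⟨Fintype.equivFin _⟩
  PMF.uniformOfFintype _

/-- The edge set of `G_{n,m}(H)`: traversing the first `m` edges of the ordering `ord`,
each traversed edge is added iff it does not complete a copy of `H` together with the
previously traversed edges. -/
def keptEdges {β : Type*} (H : SimpleGraph β) (n m : ℕ) (ord : EdgeOrder n) :
    Set (Sym2 (Fin n)) :=
  {e₀ | ∃ e : EdgeType n, e₀ = e.1 ∧ (ord e : ℕ) < m ∧
    ¬ copyAt H {f | ∃ g : EdgeType n, f = g.1 ∧ ord g ≤ ord e} e.1}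

/-- The expected number of edges of `G_{n,m}(H)`. -/
noncomputable def expKept {β : Type*} (H : SimpleGraph β) (n m : ℕ) : ℝ :=
  ∑' ord : EdgeOrder n, ((ordPMF n) ord).toReal * ((keptEdges H n m ord).ncard : ℝ)


section Aux
open Classical

noncomputable def occ {E : Type*} [DecidableEq E] {r : ℕ} (t : Fin r → E) (c : E) : ℝ :=
  ∑ j, if t j = c then (1:ℝ) else 0

lemma occ_cons {E : Type*} [DecidableEq E] {r : ℕ} (x : E) (t : Fin r → E) (c : E) :
    occ (Fin.cons x t : Fin (r+1) → E) c = (if x = c then (1:ℝ) else 0) + occ t c := by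
  unfold occ
  rw [Fin.sum_univ_succ]
  simp only [Fin.cons_zero, Fin.cons_succ]

lemma sum_cons {E : Type*} [Fintype E] {r : ℕ} (F : (Fin (r+1) → E) → ℝ) :
    ∑ t, F t = ∑ x : E, ∑ t : Fin r → E, F (Fin.cons x t) := by
  rw [← (Fin.consEquiv (fun _ : Fin (r+1) => E)).sum_comp, Fintype.sum_prod_type]
  rfl

lemma sum_occ {E : Type*} [DecidableEq E] [Fintype E] [Nonempty E] (r : ℕ) (c : E) :
    ∑ t : Fin r → E, occ t c = (Fintype.card E : ℝ)^r * (r / Fintype.card E) := by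
  have hN : (Fintype.card E : ℝ) ≠ 0 := by simp
  induction r with
  | zero => simp [occ]
  | succ r ih =>
    rw [sum_cons]
    simp only [occ_cons, Finset.sum_add_distrib, ih]
    simp
    field_simp
    ring

lemma sum_occ2 {E : Type*} [DecidableEq E] [Fintype E] [Nonempty E] (r : ℕ) (c c' : E) :
    ∑ t : Fin r → E, occ t c * occ t c' ≤ (Fintype.card E : ℝ)^r *
      ((r / Fintype.card E)^2 + (r / Fintype.card E) * (if c = c' then 1 else 0)) := by
  have hN : (0:ℝ) < (Fintype.card E : ℝ) := by
    exact_mod_cast Fintype.card_pos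
  induction r with
  | zero => simp [occ]
  | succ r ih =>
    rw [sum_cons]
    simp only [occ_cons, add_mul, mul_add, Finset.sum_add_distrib]
    have h1 : ∑ x : E, ∑ t : Fin r → E, ((if x = c then (1:ℝ) else 0) * (if x = c' then (1:ℝ) else 0))
       = (Fintype.card E : ℝ)^r * (if c = c' then 1 else 0) := by
      by_cases h : c = c'
      · subst h; simp
      · have h' : ¬ c' = c := fun q => h q.symm
        simp [h, h']
    rw [h1]
    simp only [← Finset.mul_sum, ← Finset.sum_mul, sum_occ]
    simp only [Finset.sum_const, Finset.card_univ, nsmul_eq_mul, Finset.sum_ite_eq', Finset.mem_univ, if_true]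
    set N := (Fintype.card E : ℝ)
    set d : ℝ := (if c = c' then 1 else 0)
    set B := ∑ t : Fin r → E, occ t c * occ t c'
    have : N * B ≤ N * (N ^ r * ((↑r / N) ^ 2 + ↑r / N * d)) := by gcongr
    have e : N ^ (r+1) * ((((r+1:ℕ):ℝ)/N)^2 + ((r+1:ℕ):ℝ)/N * d) =
      N * (N ^ r * ((↑r / N) ^ 2 + ↑r / N * d)) + N^r*d + 2 * (N^r * (r/N)) + N^r / N := by
      push_cast; field_simp; ring
    have : 0 ≤ N^r/N := by positivity
    rw [mul_add] at e
    simp only [d] at *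
    linarith

lemma second_moment {E τ Φ : Type*} [DecidableEq E] [DecidableEq τ] [Fintype E] [Nonempty E] [Fintype τ] [Fintype Φ]
    (img : Φ → τ → E) (r : ℕ) (hr : 0 < r) :
    ((Finset.univ.filter (fun s : τ → Fin r → E => ∀ φ, ∃ f, ∀ j, s f j ≠ img φ f)).card : ℝ)
      * (Fintype.card Φ : ℝ)^2 ≤
    ((Fintype.card E : ℝ)^r)^(Fintype.card τ) *
      ((∑ φ, ∑ φ', ∏ f, (1 + (Fintype.card E : ℝ) / r * (if img φ f = img φ' f then (1:ℝ) else 0)))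
        - (Fintype.card Φ : ℝ)^2) := by
  set N := (Fintype.card E : ℝ) with hNdef
  have hN : (0:ℝ) < N := by
    have : 0 < Fintype.card E := Fintype.card_pos
    rw [hNdef]; exact_mod_cast this
  set k := Fintype.card τ
  set p : ℝ := r / N with hp
  have hr' : (0:ℝ) < r := by exact_mod_cast hr
  have hp0 : 0 < p := by positivity
  let X : (τ → Fin r → E) → ℝ := fun s => ∑ φ, ∏ f, occ (s f) (img φ f)
  have fub : ∀ g : τ → (Fin r → E) → ℝ, ∑ s : τ → Fin r → E, ∏ f, g f (s f) = ∏ f, ∑ t, g f t := by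
    intro g
    rw [Finset.prod_univ_sum]
    simp
  have m1 : ∑ s, X s = (N^r)^k * (Fintype.card Φ * p^k) := by
    simp only [X]
    rw [Finset.sum_comm]
    simp only [fun φ => fub (fun f t => occ t (img φ f)), sum_occ]
    simp [mul_pow, k, p, N]
    ring
  have m2 : ∑ s, X s ^ 2 ≤ (N^r)^k * (p^2)^k * ∑ φ, ∑ φ', ∏ f, (1 + N / r * (if img φ f = img φ' f then (1:ℝ) else 0)) := by
    simp only [X, sq (∑ φ, _), Finset.sum_mul_sum, ← Finset.prod_mul_distrib]
    rw [Finset.sum_comm, Finset.mul_sum]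
    refine Finset.sum_le_sum fun φ _ => ?_
    rw [Finset.sum_comm, Finset.mul_sum]
    refine Finset.sum_le_sum fun φ' _ => ?_
    rw [fub (fun f t => occ t (img φ f) * occ t (img φ' f)), ← mul_pow]
    have : (N^r * p^2)^k = ∏ f : τ, (N^r * p^2) := by simp [k]
    rw [this, ← Finset.prod_mul_distrib]
    refine Finset.prod_le_prod (fun f _ => ?_) (fun f _ => ?_)
    · refine Finset.sum_nonneg fun t _ => mul_nonneg ?_ ?_ <;>
      · unfold occ
        exact Finset.sum_nonneg fun j _ => by split_ifs <;> norm_num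
    · refine (sum_occ2 r _ _).trans (le_of_eq ?_)
      rw [← hNdef, hp]
      field_simp
  set Q := ∑ φ, ∑ φ', ∏ f, (1 + N / r * (if img φ f = img φ' f then (1:ℝ) else 0))
  set μ : ℝ := Fintype.card Φ * p^k with hμ
  have tot : ∑ s : τ → Fin r → E, (1:ℝ) = (N^r)^k := by
    simp [N, k]
  have cheb : ((Finset.univ.filter (fun s : τ → Fin r → E => ∀ φ, ∃ f, ∀ j, s f j ≠ img φ f)).card : ℝ) * μ^2
      ≤ ∑ s, (X s - μ)^2 := by
    rw [Finset.card_eq_sum_ones, Nat.cast_sum, Finset.sum_mul]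
    refine le_trans ?_ (Finset.sum_le_sum_of_subset_of_nonneg (Finset.filter_subset
      (fun s : τ → Fin r → E => ∀ φ, ∃ f, ∀ j, s f j ≠ img φ f) _) (fun s _ _ => sq_nonneg _))
    refine Finset.sum_le_sum fun s hs => ?_
    have hs := (Finset.mem_filter.1 hs).2
    have : X s = 0 := by
      refine Finset.sum_eq_zero fun φ _ => ?_
      obtain ⟨f, hf⟩ := hs φ
      refine Finset.prod_eq_zero (Finset.mem_univ f) ?_
      simp [occ, hf]
    rw [this]; simp
  have ex : ∑ s, (X s - μ)^2 = ∑ s, X s^2 - (N^r)^k * μ^2 := by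
    have : ∀ s, (X s - μ)^2 = X s^2 - 2*μ * X s + μ^2 * 1 := fun s => by ring
    simp only [this, Finset.sum_add_distrib, Finset.sum_sub_distrib, ← Finset.mul_sum, tot, m1]
    ring
  have hfin := cheb.trans (ex.le.trans (sub_le_sub_right m2 _))
  have hpk : 0 < (p^k)^2 := by positivity
  have e1 : μ^2 = (Fintype.card Φ : ℝ)^2 * (p^k)^2 := by rw [hμ]; ring
  have e2 : (p^2)^k = (p^k)^2 := by ring
  rw [e1, e2] at hfin
  refine le_of_mul_le_mul_right ?_ hpk
  calc _ = _ := by ring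
    _ ≤ _ := hfin
    _ = _ := by ring

lemma iid_compare {E ι : Type*} [Fintype E] [Fintype ι] [DecidableEq ι] (N : ℕ)
    [Fintype (E ≃ Fin N)] (bad : Set E → Prop)
    (hbad : ∀ S T, S ⊆ T → bad T → bad S) (m : ℕ) (hι : Fintype.card ι ≤ m)
    (hm : m ≤ N) :
    (Finset.univ.filter (fun o : E ≃ Fin N => bad {g | (o g : ℕ) < m})).card
       * N ^ Fintype.card ι ≤
    Fintype.card (E ≃ Fin N) *
      (Finset.univ.filter (fun s : ι → E => bad (Set.range s))).card := by
  have key : ∀ s : ι → Fin N,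
     (Finset.univ.filter (fun o : E ≃ Fin N => bad {g | (o g : ℕ) < m})).card ≤
     (Finset.univ.filter (fun o : E ≃ Fin N => bad (Set.range (o.symm ∘ s)))).card := by
    intro s
    obtain ⟨σ, hσ⟩ : ∃ σ : Equiv.Perm (Fin N), ∀ i, (σ (s i) : ℕ) < m := by
      have h1 : (Finset.univ.image s).card ≤ m :=
        Finset.card_image_le.trans (by simpa using hι)
      obtain ⟨A, hA, -, hAc⟩ := Finset.exists_subsuperset_card_eq (Finset.subset_univ (Finset.univ.image s)) h1 (by simpa using hm)
      have hc : Fintype.card {x // x ∈ A} = Fintype.card {x : Fin N // (x:ℕ) < m} := by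
        rw [Fintype.card_coe, hAc, Fintype.card_subtype, Fin.card_filter_val_lt]
        omega
      let eq := Fintype.equivOfCardEq hc
      refine ⟨eq.extendSubtype, fun i => ?_⟩
      exact eq.extendSubtype_mem (s i) (hA (by simp))
    refine Finset.card_le_card_of_injOn (fun o => o.trans σ.symm) ?_ ?_
    · intro o ho
      simp only [Finset.coe_filter, Finset.mem_univ, true_and, Set.mem_ofPred_eq] at ho ⊢
      refine hbad _ _ ?_ ho
      rintro _ ⟨i, rfl⟩
      simpa using hσ i
    · intro o _ o' _ h
      ext x
      have := congrArg (fun q => σ (q x)) h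
      simp at this
      rw [this]
  have key2 : ∀ o : E ≃ Fin N,
      (Finset.univ.filter (fun s : ι → Fin N => bad (Set.range (o.symm ∘ s)))).card =
      (Finset.univ.filter (fun s : ι → E => bad (Set.range s))).card := by
    intro o
    refine Finset.card_equiv ((Equiv.refl ι).arrowCongr o.symm) ?_
    intro s
    simp
    rfl
  have hsum : ∑ s : ι → Fin N, (Finset.univ.filter (fun o : E ≃ Fin N => bad (Set.range (o.symm ∘ s)))).card
      = ∑ o : E ≃ Fin N, (Finset.univ.filter (fun s : ι → Fin N => bad (Set.range (o.symm ∘ s)))).card := by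
    simp only [Finset.card_filter]
    exact Finset.sum_comm
  have h := Finset.sum_le_sum (s := Finset.univ) fun s _ => key s
  rw [hsum] at h
  simp only [key2, Finset.sum_const, Finset.card_univ, smul_eq_mul] at h
  simp only [Fintype.card_fun, Fintype.card_fin] at h
  linarith [h]

end Aux

section Aux2
open Classical
set_option linter.unusedSectionVars false

variable {β : Type*} [Fintype β]

/-- The edges of `H` different from the root edge. -/
abbrev RootTau (H : SimpleGraph β) (a b : β) := {f : Sym2 β // f ∈ H.edgeSet ∧ f ≠ s(a, b)}

abbrev RootEmb (a b : β) {n : ℕ} (x y : Fin n) :=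
  {u : β // u ≠ a ∧ u ≠ b} ↪ {z : Fin n // z ≠ x ∧ z ≠ y}

noncomputable def rext {a b : β} {n : ℕ} {x y : Fin n} (ψ : RootEmb a b x y) (u : β) : Fin n :=
  if h : u = a then x else if h' : u = b then y else (ψ ⟨u, h, h'⟩).1

lemma rext_a {a b : β} {n : ℕ} {x y : Fin n} (ψ : RootEmb a b x y) : rext ψ a = x := by
  simp [rext]

lemma rext_b {a b : β} (hab : a ≠ b) {n : ℕ} {x y : Fin n} (ψ : RootEmb a b x y) :
    rext ψ b = y := by
  simp [rext, hab.symm]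

lemma rext_of {a b : β} {n : ℕ} {x y : Fin n} (ψ : RootEmb a b x y) (u : β) (h : u ≠ a)
    (h' : u ≠ b) : rext ψ u = (ψ ⟨u, h, h'⟩).1 := by
  simp [rext, h, h']

lemma rext_inj {a b : β} (hab : a ≠ b) {n : ℕ} {x y : Fin n} (hxy : x ≠ y) (ψ : RootEmb a b x y) :
    Function.Injective (rext ψ) := by
  have hx : ∀ u, u ≠ a → u ≠ b → rext ψ u ≠ x ∧ rext ψ u ≠ y := by
    intro u h h'
    rw [rext_of ψ u h h']; exact (ψ ⟨u, h, h'⟩).2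
  intro u w huw
  by_cases hua : u = a <;> by_cases hub : u = b <;> by_cases hwa : w = a <;> by_cases hwb : w = b
  all_goals first
    | (subst hua; subst hub; exact absurd rfl hab)
    | (subst hwa; subst hwb; exact absurd rfl hab)
    | (exact hua.trans hwa.symm)
    | (exact hub.trans hwb.symm)
    | skip
  · rw [hua, hwb, rext_a, rext_b hab] at huw; exact absurd huw hxy
  · rw [hua, rext_a] at huw; exact absurd huw.symm (hx w hwa hwb).1
  · rw [hub, hwa, rext_a, rext_b hab] at huw; exact absurd huw.symm hxy
  · rw [hub, rext_b hab] at huw; exact absurd huw.symm (hx w hwa hwb).2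
  · rw [hwa, rext_a] at huw; exact absurd huw (hx u hua hub).1
  · rw [hwb, rext_b hab] at huw; exact absurd huw (hx u hua hub).2
  · rw [rext_of ψ u hua hub, rext_of ψ w hwa hwb] at huw
    have := ψ.injective (Subtype.ext huw)
    exact congrArg Subtype.val this

lemma rext_injective {a b : β} {n : ℕ} {x y : Fin n} :
    Function.Injective (rext : RootEmb a b x y → β → Fin n) := by
  intro ψ ψ' h
  ext ⟨u, hu, hu'⟩
  have := congrFun h u
  rw [rext_of ψ u hu hu', rext_of ψ' u hu hu'] at this
  rw [this]

noncomputable def rimg (H : SimpleGraph β) {a b : β} (hab : a ≠ b) {n : ℕ} {x y : Fin n}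
    (hxy : x ≠ y) (ψ : RootEmb a b x y) (f : RootTau H a b) : EdgeType n :=
  ⟨Sym2.map (rext ψ) f.1, by
    obtain ⟨f, hf, -⟩ := f
    induction f with
    | _ u w =>
      simp only [Sym2.map_mk, Sym2.mk_isDiag_iff]
      exact fun h => H.ne_of_adj hf (rext_inj hab hxy ψ h)⟩

/-- Vertices spanned by `T` and the root edge. -/
noncomputable def rverts {H : SimpleGraph β} {a b : β} (T : Finset (RootTau H a b)) : Finset β :=
  Finset.univ.filter fun u => u = a ∨ u = b ∨ ∃ f ∈ T, u ∈ f.1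

/-- Number of `ψ'` agreeing with `φ` on `T`. -/
noncomputable def agreeCard {E τ Φ : Type*} [Fintype Φ] (img : Φ → τ → E) (φ : Φ)
    (T : Finset τ) : ℕ :=
  (Finset.univ.filter fun ψ' : Φ => ∀ f ∈ T, img φ f = img ψ' f).card

lemma agreeCard_le {E τ Φ γ : Type*} [Fintype Φ] (img : Φ → τ → E) (φ : Φ)
    (T : Finset τ) (S : Finset γ) (g : Φ → γ) (hg : Function.Injective g)
    (h : ∀ ψ', (∀ f ∈ T, img φ f = img ψ' f) → g ψ' ∈ S) : agreeCard img φ T ≤ S.card := by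
  unfold agreeCard
  refine Finset.card_le_card_of_injOn g ?_ hg.injOn
  intro ψ' hψ
  exact h ψ' (Finset.mem_filter.1 hψ).2

lemma card_agree (H : SimpleGraph β) {a b : β} (hab : a ≠ b) {n : ℕ} {x y : Fin n}
    (hxy : x ≠ y) (ψ : RootEmb a b x y) (T : Finset (RootTau H a b)) :
    agreeCard (rimg H hab hxy) ψ T ≤
    (Fintype.card β) ^ (Fintype.card β) * n ^ (Fintype.card β - (rverts T).card) := by
  have hv : 0 < Fintype.card β := Fintype.card_pos_iff.2 ⟨a⟩
  have h1 : agreeCard (rimg H hab hxy) ψ T ≤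
      (Fintype.piFinset fun u : β => if u ∈ rverts T then Finset.univ.image (rext ψ) else Finset.univ).card := by
    refine agreeCard_le _ _ _ _ rext rext_injective ?_
    intro ψ' h
    simp only [Fintype.mem_piFinset]
    intro u
    split_ifs with hu
    · simp only [rverts, Finset.mem_filter, Finset.mem_univ, true_and] at hu
      rcases hu with rfl | rfl | ⟨f, hf, huf⟩
      · exact Finset.mem_image.2 ⟨u, Finset.mem_univ _, by rw [rext_a, rext_a]⟩
      · exact Finset.mem_image.2 ⟨u, Finset.mem_univ _, by rw [rext_b hab, rext_b hab]⟩
      · have hh := congrArg Subtype.val (h f hf)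
        simp only [rimg] at hh
        have : rext ψ' u ∈ Sym2.map (rext ψ') f.1 := Sym2.mem_map.2 ⟨u, huf, rfl⟩
        rw [← hh] at this
        obtain ⟨w, -, hw⟩ := Sym2.mem_map.1 this
        rw [← hw]; simp
    · simp
  refine h1.trans ?_
  rw [Fintype.card_piFinset]
  have h2 : ∀ u : β, (if u ∈ rverts T then Finset.univ.image (rext ψ) else Finset.univ).card ≤
      if u ∈ rverts T then Fintype.card β else n := by
    intro u
    split_ifs
    · exact Finset.card_image_le
    · simp
  refine (Finset.prod_le_prod' fun u _ => h2 u).trans ?_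
  rw [Finset.prod_ite]
  simp only [Finset.prod_const]
  have e1 : (Finset.univ.filter fun u => u ∈ rverts T) = rverts T := by ext; simp
  have e2 : (Finset.univ.filter fun u => u ∉ rverts T).card = Fintype.card β - (rverts T).card := by
    rw [← Finset.card_compl]; congr 1; ext; simp
  rw [e1, e2]
  gcongr
  exact Finset.card_le_univ _

lemma card_emb_lower {a b : β} (hab : a ≠ b) {n : ℕ} {x y : Fin n}
    (hxy : x ≠ y) (hn : 2 * Fintype.card β ≤ n) :
    n ^ (Fintype.card β - 2) ≤ 2 ^ (Fintype.card β - 2) * Fintype.card (RootEmb a b x y) := by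
  have c1 : Fintype.card {u : β // u ≠ a ∧ u ≠ b} = Fintype.card β - 2 := by
    rw [Fintype.card_subtype]
    have : (Finset.univ.filter fun u => u ≠ a ∧ u ≠ b) = ({a, b} : Finset β)ᶜ := by
      ext; simp
    rw [this, Finset.card_compl, Finset.card_pair hab]
  have c2 : Fintype.card {u : Fin n // u ≠ x ∧ u ≠ y} = n - 2 := by
    rw [Fintype.card_subtype]
    have : (Finset.univ.filter fun u => u ≠ x ∧ u ≠ y) = ({x, y} : Finset (Fin n))ᶜ := by
      ext; simp
    rw [this, Finset.card_compl, Finset.card_pair hxy, Fintype.card_fin]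
  rw [Fintype.card_embedding_eq, c1, c2]
  have hv : 2 ≤ Fintype.card β := by
    have := Finset.card_le_univ ({a, b} : Finset β)
    rwa [Finset.card_pair hab] at this
  refine le_trans ?_ (Nat.mul_le_mul_left _ (Nat.pow_sub_le_descFactorial _ _))
  rw [← mul_pow]
  gcongr
  omega

lemma sum_finset_bound {τ : Type*} [Fintype τ] (F : Finset τ → ℝ) (A B : ℝ) (hB : 0 ≤ B)
    (h0 : F ∅ = A) (h1 : ∀ T : Finset τ, T.Nonempty → F T ≤ B) :
    (∑ T, F T) - A ≤ 2 ^ Fintype.card τ * B := by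
  rw [← Finset.add_sum_erase _ _ (Finset.mem_univ ∅), h0, add_sub_cancel_left]
  refine (Finset.sum_le_sum (fun T hT => h1 T (Finset.nonempty_iff_ne_empty.2
    (Finset.ne_of_mem_erase hT)))).trans ?_
  rw [Finset.sum_const, nsmul_eq_mul]
  gcongr
  have : (Finset.univ.erase (∅ : Finset τ)).card ≤ 2 ^ Fintype.card τ :=
    (Finset.card_le_univ _).trans (le_of_eq (by simp))
  exact_mod_cast this

lemma expand_bound {E τ Φ : Type*} [DecidableEq E] [Fintype τ] [Fintype Φ] (img : Φ → τ → E) (L B : ℝ) (hB : 0 ≤ B)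
    (h1 : ∀ T : Finset τ, T.Nonempty → L ^ T.card * ∑ φ : Φ, (agreeCard img φ T : ℝ) ≤ B) :
    (∑ φ : Φ, ∑ φ' : Φ, ∏ f, (1 + L * (if img φ f = img φ' f then (1:ℝ) else 0))) -
      (Fintype.card Φ : ℝ) ^ 2 ≤ 2 ^ Fintype.card τ * B := by
  have expand : (∑ φ : Φ, ∑ φ' : Φ, ∏ f, (1 + L *
      (if img φ f = img φ' f then (1:ℝ) else 0))) =
      ∑ T : Finset (τ), L ^ T.card * ∑ φ : Φ,
        (agreeCard img φ T : ℝ) := by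
    have h1 : ∀ φ φ' : Φ, ∏ f, (1 + L *
      (if img φ f = img φ' f then (1:ℝ) else 0)) =
      ∑ T : Finset (τ), L ^ T.card *
        (if ∀ f ∈ T, img φ f = img φ' f then (1:ℝ) else 0) := by
      intro φ φ'
      rw [Finset.prod_one_add, Finset.powerset_univ]
      refine Finset.sum_congr rfl fun T _ => ?_
      rw [Finset.prod_mul_distrib, Finset.prod_const, Finset.prod_ite_zero]
      simp
    simp only [h1]
    have h2 : ∀ φ : Φ, (∑ φ' : Φ, ∑ T : Finset (τ), L ^ T.card *
        (if ∀ f ∈ T, img φ f = img φ' f then (1:ℝ) else 0)) =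
        ∑ T : Finset (τ), L ^ T.card * (agreeCard img φ T : ℝ) := by
      intro φ
      rw [Finset.sum_comm]
      refine Finset.sum_congr rfl fun T _ => ?_
      rw [← Finset.mul_sum]
      simp [agreeCard]
      left
      congr
    simp only [h2]
    rw [Finset.sum_comm]
    simp only [Finset.mul_sum]
  have e0 : L ^ (∅ : Finset τ).card * ∑ φ : Φ,
        (agreeCard img φ (∅ : Finset τ) : ℝ) = (Fintype.card Φ : ℝ)^2 := by
    simp [sq, agreeCard]
  rw [expand]
  exact sum_finset_bound _ _ _ hB e0 h1

lemma term_arith (A S η n P V D : ℝ) (v w : ℕ) (h3 : 3 ≤ w) (hwv : w ≤ v) (hη0 : 0 ≤ η)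
    (hη : η ≤ 1) (hn0 : 0 ≤ n) (hP : 0 ≤ P) (hV : 0 ≤ V) (hS0 : 0 ≤ S)
    (hA : A ≤ (η * n) ^ (w - 2)) (hS : S ≤ P * (V * n ^ (v - w))) (hlow : n ^ (v - 2) ≤ D * P) :
    A * S ≤ V * D * η * P ^ 2 := by
  have b3 : η ^ (w-2) ≤ η := by
    have := pow_le_pow_of_le_one hη0 hη (show 1 ≤ w-2 by omega)
    simpa using this
  calc A * S ≤ (η * n)^(w-2) * (P * (V * n^(v-w))) := by gcongr
    _ = η^(w-2) * (P * V * (n^(w-2) * n^(v-w))) := by rw [mul_pow]; ring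
    _ = η^(w-2) * (P * V * n^(v-2)) := by
          rw [← pow_add]; congr 3; omega
    _ ≤ η * (P * V * (D * P)) := by gcongr
    _ = _ := by ring

set_option maxHeartbeats 1000000 in
lemma round_bad (H : SimpleGraph β) {a b : β} (hab : a ≠ b) {n : ℕ} {x y : Fin n}
    (hxy : x ≠ y) (hn : 2 * Fintype.card β ≤ n) (d η : ℝ) (hη : η ≤ 1) (r : ℕ) (hr : 0 < r)
    (hrN : r ≤ Fintype.card (EdgeType n))
    (hd : ∀ T : Finset (RootTau H a b), T.Nonempty → 3 ≤ (rverts T).card ∧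
      (T.card : ℝ) ≤ d * ((rverts T).card - 2))
    (hL : ((Fintype.card (EdgeType n) : ℝ) / r) ^ d ≤ η * n) :
    ((Finset.univ.filter (fun s : RootTau H a b → Fin r → EdgeType n =>
        ∀ ψ : RootEmb a b x y, ∃ f, ∀ j, s f j ≠ rimg H hab hxy ψ f)).card : ℝ) ≤
    ((Fintype.card (EdgeType n) : ℝ)^r)^(Fintype.card (RootTau H a b)) *
      (2 ^ (Fintype.card (RootTau H a b)) * (Fintype.card β) ^ (Fintype.card β) *
        2 ^ (Fintype.card β - 2) * η) := by
  have hNpos : 0 < Fintype.card (EdgeType n) := hr.trans_le hrN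
  have : Nonempty (EdgeType n) := Fintype.card_pos_iff.1 hNpos
  have hsm := second_moment (rimg H hab hxy (x := x) (y := y)) r hr
  set N := (Fintype.card (EdgeType n) : ℝ) with hN
  have hN0 : 0 < N := by rw [hN]; exact_mod_cast hNpos
  set v := Fintype.card β with hv
  set k := Fintype.card (RootTau H a b)
  set P := Fintype.card (RootEmb a b x y) with hP
  have hr0 : (0:ℝ) < r := by exact_mod_cast hr
  have hvpos : 0 < v := Fintype.card_pos_iff.2 ⟨a⟩
  have hn0 : (0:ℝ) < n := by
    have : 0 < n := by omega
    exact_mod_cast this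
  set L := N / r with hLdef
  have hL1 : 1 ≤ L := by
    rw [hLdef, one_le_div hr0]
    rw [hN]; exact_mod_cast hrN
  have hL0 : 0 < L := by linarith
  have hlow : (n:ℝ)^(v-2) ≤ 2^(v-2) * P := by
    have := card_emb_lower hab hxy hn
    exact_mod_cast this
  have hP0 : (0:ℝ) < P := by
    have : 0 < (n:ℝ)^(v-2) := by positivity
    by_contra hc
    have : (2:ℝ)^(v-2) * P ≤ 0 := mul_nonpos_of_nonneg_of_nonpos (by positivity) (not_lt.1 hc)
    linarith
  have hη0 : 0 < η := by
    have h0 : 0 < L ^ d := Real.rpow_pos_of_pos hL0 d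
    exact pos_of_mul_pos_left (h0.trans_le hL) hn0.le
  have termbd : ∀ T : Finset (RootTau H a b), T.Nonempty →
      L ^ T.card * ∑ φ : RootEmb a b x y,
        (agreeCard (rimg H hab hxy) φ T : ℝ) ≤
      (v:ℝ)^v * 2^(v-2) * η * (P:ℝ)^2 := by
    intro T hT
    obtain ⟨h3, hle⟩ := hd T hT
    set w := (rverts T).card
    have hwv : w ≤ v := Finset.card_le_univ _
    have b1 : ∑ φ : RootEmb a b x y,
        (agreeCard (rimg H hab hxy) φ T : ℝ) ≤
        P * ((v:ℝ)^v * (n:ℝ)^(v-w)) := by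
      have : ∀ φ ∈ (Finset.univ : Finset (RootEmb a b x y)),
        (agreeCard (rimg H hab hxy) φ T : ℝ) ≤ (v:ℝ)^v * (n:ℝ)^(v-w) := by
        intro φ _
        exact_mod_cast card_agree H hab hxy φ T
      refine (Finset.sum_le_sum this).trans (le_of_eq ?_)
      rw [Finset.sum_const, nsmul_eq_mul, Finset.card_univ]
    have b2 : L ^ T.card ≤ (η * n)^(w-2) := by
      calc L ^ T.card = L ^ (T.card : ℝ) := (Real.rpow_natCast _ _).symm
        _ ≤ L ^ (d * ((w:ℝ) - 2)) := Real.rpow_le_rpow_of_exponent_le hL1 hle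
        _ = (L ^ d) ^ ((w-2 : ℕ) : ℝ) := by
            rw [Real.rpow_mul hL0.le]; congr 1; push_cast [show 2 ≤ w by omega]; ring
        _ = (L ^ d) ^ (w-2) := Real.rpow_natCast _ _
        _ ≤ (η * n)^(w-2) := by gcongr
    exact term_arith _ _ η n P _ _ v w h3 hwv hη0.le hη hn0.le hP0.le (by positivity) (Finset.sum_nonneg fun _ _ => Nat.cast_nonneg _) b2 b1 hlow
  have hsum : (∑ φ : RootEmb a b x y, ∑ φ' : RootEmb a b x y, ∏ f, (1 + L *
      (if rimg H hab hxy φ f = rimg H hab hxy φ' f then (1:ℝ) else 0))) - (P:ℝ)^2 ≤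
      2^k * ((v:ℝ)^v * 2^(v-2) * η * (P:ℝ)^2) := by
    have hB0 : 0 ≤ (v:ℝ)^v * 2^(v-2) * η * (P:ℝ)^2 :=
      mul_nonneg (mul_nonneg (mul_nonneg (pow_nonneg (Nat.cast_nonneg _) _)
        (pow_nonneg zero_le_two _)) hη0.le) (sq_nonneg _)
    have hh := expand_bound (rimg H hab hxy (x := x) (y := y)) L _ hB0 termbd
    exact hh
  have hP2 : (0:ℝ) < (P:ℝ)^2 := pow_pos hP0 2
  refine le_of_mul_le_mul_right (hsm.trans ?_) hP2
  calc _ ≤ (N^r)^k * (2^k * ((v:ℝ)^v * 2^(v-2) * η * (P:ℝ)^2)) := by gcongr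
    _ = _ := by ring

end Aux2

section Aux3
open Classical
set_option linter.unusedSectionVars false

variable {β : Type*} [Fintype β]

lemma three_le_rverts {H : SimpleGraph β} {a b : β} (hab : H.Adj a b)
    (T : Finset (RootTau H a b)) (hT : T.Nonempty) : 3 ≤ (rverts T).card := by
  obtain ⟨f, hf⟩ := hT
  have hsub : ({a, b} : Finset β) ⊆ rverts T := by
    intro u hu
    simp only [Finset.mem_insert, Finset.mem_singleton] at hu
    simp only [rverts, Finset.mem_filter, Finset.mem_univ, true_and]
    tauto
  have hc : ({a, b} : Finset β).card = 2 := Finset.card_pair (H.ne_of_adj hab)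
  by_contra hlt
  have heq : ({a, b} : Finset β) = rverts T :=
    Finset.eq_of_subset_of_card_le hsub (by omega)
  obtain ⟨f, hfH, hfne⟩ := f
  induction f with
  | _ u w =>
    have hu : u ∈ rverts T := by
      simp only [rverts, Finset.mem_filter, Finset.mem_univ, true_and]
      exact Or.inr (Or.inr ⟨_, hf, by simp⟩)
    have hw : w ∈ rverts T := by
      simp only [rverts, Finset.mem_filter, Finset.mem_univ, true_and]
      exact Or.inr (Or.inr ⟨_, hf, by simp⟩)
    have huw : u ≠ w := H.ne_of_adj hfH
    rw [← heq] at hu hw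
    simp only [Finset.mem_insert, Finset.mem_singleton] at hu hw
    apply hfne
    rw [Sym2.eq_iff]
    rcases hu with rfl | rfl <;> rcases hw with rfl | rfl <;> tauto

lemma edge_ncard {H : SimpleGraph β} {a b : β} (hab : H.Adj a b) :
    H.edgeSet.ncard = Fintype.card (RootTau H a b) + 1 := by
  have : H.edgeSet = insert s(a, b) (Set.range (Subtype.val : RootTau H a b → Sym2 β)) := by
    ext f
    simp only [Set.mem_insert_iff, Subtype.range_coe_subtype, Set.mem_ofPred_eq]
    constructor
    · intro h; by_cases h' : f = s(a, b) <;> tauto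
    · rintro (rfl | h)
      · exact hab
      · exact h.1
  rw [congrArg Set.ncard this, Set.ncard_insert_of_notMem (by simp), ← Set.image_univ,
    Set.ncard_image_of_injective _ Subtype.val_injective, Set.ncard_univ, Nat.card_eq_fintype_card]

lemma dens {H : SimpleGraph β} (hH : TwoBalanced H) {a b : β} (hab : H.Adj a b)
    (T : Finset (RootTau H a b)) (hT : T.Nonempty) :
    (T.card : ℝ) ≤ d2 H * ((rverts T).card - 2) := by
  have h3 := three_le_rverts hab T hT
  have h3' : (0:ℝ) < ((rverts T).card : ℝ) - 2 := by
    have : (3:ℝ) ≤ ((rverts T).card : ℝ) := by exact_mod_cast h3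
    linarith
  let G : H.Subgraph :=
    { verts := (rverts T : Set β)
      Adj := fun u w => s(u, w) = s(a, b) ∨ ∃ f ∈ T, f.1 = s(u, w)
      adj_sub := by
        rintro u w (h | ⟨f, -, h⟩)
        · have : s(u, w) ∈ H.edgeSet := by rw [h]; exact hab
          exact this
        · have : s(u, w) ∈ H.edgeSet := by rw [← h]; exact f.2.1
          exact this
      edge_vert := by
        rintro u w (h | ⟨f, hf, h⟩)
        · simp only [rverts, Finset.coe_filter, Finset.mem_univ, true_and, Set.mem_ofPred_eq]
          have : u ∈ s(a, b) := by rw [← h]; simp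
          simp at this; tauto
        · simp only [rverts, Finset.coe_filter, Finset.mem_univ, true_and, Set.mem_ofPred_eq]
          exact Or.inr (Or.inr ⟨f, hf, by rw [h]; simp⟩)
      symm := ⟨by
        intro u w h
        rw [Sym2.eq_swap (a := w)]
        exact h⟩ }
  have hE : G.edgeSet = insert s(a, b) (Set.image Subtype.val (T : Set (RootTau H a b))) := by
    ext f
    induction f with
    | _ u w =>
      rw [SimpleGraph.Subgraph.mem_edgeSet]
      simp only [G, Set.mem_insert_iff, Set.mem_image, Finset.mem_coe]
  have hEc : G.edgeSet.ncard = T.card + 1 := by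
    rw [hE, Set.ncard_insert_of_notMem, Set.ncard_image_of_injective _ Subtype.val_injective,
      Set.ncard_coe_finset]
    rintro ⟨f, -, h⟩
    exact f.2.2 h
  have hVc : G.verts.ncard = (rverts T).card := Set.ncard_coe_finset _
  rw [← div_le_iff₀ h3']
  by_cases hG : G = ⊤
  · have e1 : H.edgeSet.ncard = T.card + 1 := by
      rw [← hEc, hG, SimpleGraph.Subgraph.edgeSet_top]
    have e2 : Fintype.card β = (rverts T).card := by
      rw [← hVc, hG, SimpleGraph.Subgraph.verts_top, Set.ncard_univ, Nat.card_eq_fintype_card]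
    rw [d2, e1, e2]
    push_cast
    simp
  · have := hH.2 G hG (by rw [hVc]; exact h3)
    rw [hEc, hVc] at this
    push_cast at this
    simpa using this

lemma tau_pos {H : SimpleGraph β} (hH : TwoBalanced H) {a b : β} (hab : H.Adj a b) :
    0 < Fintype.card (RootTau H a b) := by
  have := hH.1
  rw [edge_ncard hab] at this
  omega

lemma half_le_d2 {H : SimpleGraph β} (hH : TwoBalanced H) {a b : β} (hab : H.Adj a b) :
    1 / 2 ≤ d2 H := by
  have hk := tau_pos hH hab
  have hne : (Finset.univ : Finset (RootTau H a b)).Nonempty := by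
    have := Fintype.card_pos_iff.1 hk
    exact Finset.univ_nonempty
  have h3 := three_le_rverts hab _ hne
  have hd := dens hH hab _ hne
  set w := (rverts (Finset.univ : Finset (RootTau H a b))).card with hw
  have hwv : w ≤ Fintype.card β := Finset.card_le_univ _
  set k := Fintype.card (RootTau H a b) with hkdef
  rw [Finset.card_univ] at hd
  have hw2 : w ≤ 2 + 2 * k := by
    have hsub : rverts (Finset.univ : Finset (RootTau H a b)) ⊆
        {a, b} ∪ Finset.univ.biUnion (fun f : RootTau H a b => f.1.toFinset) := by
      intro u hu
      simp only [rverts, Finset.mem_filter, Finset.mem_univ, true_and] at hu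
      simp only [Finset.mem_union, Finset.mem_insert, Finset.mem_singleton, Finset.mem_biUnion,
        Finset.mem_univ, true_and, Sym2.mem_toFinset]
      tauto
    refine (Finset.card_le_card hsub).trans ((Finset.card_union_le _ _).trans ?_)
    refine Nat.add_le_add (Finset.card_le_two) (Finset.card_biUnion_le.trans ?_)
    refine (Finset.sum_le_sum (g := fun _ => 2) fun f _ => ?_).trans (le_of_eq ?_)
    · rw [Sym2.card_toFinset]; split_ifs <;> omega
    · simp [k]; ring
  have hkr : (0:ℝ) < k := by exact_mod_cast hk
  have hwr : (3:ℝ) ≤ w := by exact_mod_cast h3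
  have hw2r : (w:ℝ) ≤ 2 + 2 * k := by exact_mod_cast hw2
  have hwpos : (0:ℝ) < (w:ℝ) - 2 := by linarith
  have : (k:ℝ) / (w - 2) ≤ d2 H := by
    change (k:ℝ) ≤ _ at hd
    rwa [div_le_iff₀ hwpos]
  refine le_trans ?_ this
  rw [le_div_iff₀ hwpos]
  linarith

/-- the constant -/
noncomputable def bigC (H : SimpleGraph β) (a b : β) : ℝ :=
  2 ^ (Fintype.card (RootTau H a b)) * (Fintype.card β) ^ (Fintype.card β) *
        2 ^ (Fintype.card β - 2)

lemma edge_bound {H : SimpleGraph β} (hH : TwoBalanced H) {a b : β} (hab : H.Adj a b) {n : ℕ}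
    (e : EdgeType n) (hn : 2 * Fintype.card β ≤ n) (η : ℝ) (hη : η ≤ 1) (r K m : ℕ) (hr : 0 < r)
    (hm : m ≤ Fintype.card (EdgeType n)) (hrN : r ≤ Fintype.card (EdgeType n))
    (hK : K * (Fintype.card (RootTau H a b) * r) ≤ m)
    (hL : ((Fintype.card (EdgeType n) : ℝ) / r) ^ (d2 H) ≤ η * n) :
    ((Finset.univ.filter (fun o : EdgeOrder n =>
      ¬ copyAt H (insert e.1 (Set.image Subtype.val {g : EdgeType n | (o g : ℕ) < m})) e.1)).card : ℝ) ≤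
    Fintype.card (EdgeOrder n) * (bigC H a b * η) ^ K := by
  obtain ⟨x, y, hxy, he⟩ : ∃ x y : Fin n, x ≠ y ∧ e.1 = s(x, y) := by
    obtain ⟨e, he⟩ := e
    induction e with
    | _ x y => exact ⟨x, y, by simpa using he, rfl⟩
  have hne := H.ne_of_adj hab
  have hround := round_bad H hne hxy hn (d2 H) η hη r hr hrN
    (fun T hT => ⟨three_le_rverts hab T hT, dens hH hab T hT⟩) hL
  set B := Finset.univ.filter (fun s : RootTau H a b → Fin r → EdgeType n =>
        ∀ ψ : RootEmb a b x y, ∃ f, ∀ j, s f j ≠ rimg H hne hxy ψ f) with hB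
  obtain ⟨bad, hbd⟩ : ∃ bad : Set (EdgeType n) → Prop,
    ∀ S, bad S ↔ ¬ copyAt H (insert e.1 (Set.image Subtype.val S)) e.1 := ⟨_, fun _ => Iff.rfl⟩
  have hbad : ∀ S T, S ⊆ T → bad T → bad S := by
    simp only [hbd]
    intro S T hST hT hS
    apply hT
    obtain ⟨φ, h1, h2⟩ := hS
    refine ⟨φ, fun u w huw => ?_, h2⟩
    exact Set.insert_subset_insert (Set.image_mono hST) (h1 u w huw)
  have hι : Fintype.card (Fin K × RootTau H a b × Fin r) ≤ m := by
    simpa using hK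
  have hcmp := iid_compare _ bad hbad m hι hm
  have hcount : (Finset.univ.filter (fun s : Fin K × RootTau H a b × Fin r → EdgeType n =>
      bad (Set.range s))).card ≤ B.card ^ K := by
    have : (Fintype.piFinset fun _ : Fin K => B).card = B.card ^ K := by simp
    rw [← this]
    refine Finset.card_le_card_of_injOn (fun s i f j => s (i, f, j)) ?_ ?_
    · intro s hs
      have hs := (Finset.mem_filter.1 hs).2
      simp only [Finset.mem_coe, Fintype.mem_piFinset]
      intro i
      rw [hB, Finset.mem_filter]
      refine ⟨Finset.mem_univ _, fun ψ => ?_⟩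
      by_contra hcon
      push Not at hcon
      refine (hbd _).1 hs ?_
      refine ⟨⟨rext ψ, rext_inj hne hxy ψ⟩, ?_, a, b, hab, ?_⟩
      · intro u w huw
        by_cases hu : s(u, w) = s(a, b)
        · left
          have := congrArg (Sym2.map (rext ψ)) hu
          simp only [Sym2.map_mk, rext_a, rext_b hne] at this
          rw [he]; exact this
        · right
          obtain ⟨j, hj⟩ := hcon ⟨s(u, w), huw, hu⟩
          exact ⟨_, ⟨(i, ⟨s(u, w), huw, hu⟩, j), rfl⟩, by rw [hj]; rfl⟩
      · rw [he]
        simp [rext_a, rext_b hne]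
    · intro s _ s' _ h
      funext ⟨i, f, j⟩
      exact congrFun (congrFun (congrFun h i) f) j
  have hNpos : 0 < Fintype.card (EdgeType n) := hr.trans_le hrN
  set N := Fintype.card (EdgeType n) with hN
  have hN0 : (0:ℝ) < N := by exact_mod_cast hNpos
  have hcard : Fintype.card (Fin K × RootTau H a b × Fin r) = r * Fintype.card (RootTau H a b) * K := by
    simp; ring
  rw [hcard] at hcmp
  have hpos : (0:ℝ) < (N:ℝ) ^ (r * Fintype.card (RootTau H a b) * K) := by positivity
  refine le_of_mul_le_mul_right ?_ hpos
  have h1 : ((Finset.univ.filter (fun o : EdgeOrder n =>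
      ¬ copyAt H (insert e.1 (Set.image Subtype.val {g : EdgeType n | (o g : ℕ) < m})) e.1)).card : ℝ) *
      (N:ℝ) ^ (r * Fintype.card (RootTau H a b) * K) ≤ (Fintype.card (EdgeOrder n) : ℝ) * (B.card : ℝ) ^ K := by
    have := hcmp.trans (Nat.mul_le_mul_left _ hcount)
    have h := (Nat.cast_le (α := ℝ)).2 this
    push_cast at h
    simp only [hbd] at h
    exact h
  refine h1.trans ?_
  have h2 : (B.card : ℝ) ^ K ≤ (((N:ℝ) ^ r) ^ Fintype.card (RootTau H a b) * (bigC H a b * η)) ^ K := by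
    gcongr
    exact hround
  calc _ ≤ (Fintype.card (EdgeOrder n) : ℝ) * (((N:ℝ) ^ r) ^ Fintype.card (RootTau H a b) * (bigC H a b * η)) ^ K := by
        gcongr
    _ = _ := by rw [mul_pow, ← pow_mul, ← pow_mul]; ring

end Aux3

section Aux4
open Classical

lemma card_edge_le (n : ℕ) : Fintype.card (EdgeType n) ≤ n ^ 2 := by
  have h : Fintype.card (EdgeType n) = n.choose 2 := by
    simpa using (Sym2.card_subtype_not_diag (α := Fin n))
  rw [h]
  exact Nat.choose_le_pow n 2

lemma final_count {α : Type*} [Fintype α] [Nonempty α] (A : Set α) (ε : ℝ)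
    (h : ((Finset.univ.filter fun x => x ∉ A).card : ℝ) ≤ Fintype.card α * ε) :
    ENNReal.ofReal (1 - ε) ≤ prOf (PMF.uniformOfFintype α) A := by
  have hM : (0:ℝ) < Fintype.card α := by exact_mod_cast Fintype.card_pos (α := α)
  have e1 : prOf (PMF.uniformOfFintype α) A =
      ENNReal.ofReal (((Finset.univ.filter fun x => x ∈ A).card : ℝ) / Fintype.card α) := by
    unfold prOf
    rw [tsum_fintype]
    simp only [PMF.uniformOfFintype_apply, Finset.sum_const, nsmul_eq_mul, Finset.card_univ]
    rw [ENNReal.ofReal_div_of_pos hM, ENNReal.ofReal_natCast, ENNReal.ofReal_natCast,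
      ENNReal.div_eq_inv_mul, mul_comm, Fintype.card_subtype]
  rw [e1]
  apply ENNReal.ofReal_le_ofReal
  have hs := Finset.card_filter_add_card_filter_not (s := (Finset.univ : Finset α)) (fun x => x ∈ A)
  have hs' : ((Finset.univ.filter fun x => x ∈ A).card : ℝ) +
    ((Finset.univ.filter fun x => x ∉ A).card : ℝ) = Fintype.card α := by
    exact_mod_cast hs
  rw [le_div_iff₀ hM]
  linarith

/-- Numerical estimate. -/
lemma numerics (n k m N : ℕ) (d η : ℝ) (hd : 1 / 2 ≤ d) (hk : 0 < k) (hη : 0 < η)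
    (hn : 1 ≤ n) (hN : N ≤ n ^ 2)
    (hl1 : 1 ≤ Real.log n) (hl2 : 2 * k ≤ Real.log n)
    (hl3 : 4 * k / η ^ (1 / d) ≤ Real.log n)
    (hm : (n : ℝ) ^ (2 - 1 / d) * Real.log n ^ 2 ≤ m) (hmN : m ≤ N) :
    ∃ r K : ℕ, 0 < r ∧ r ≤ N ∧ K * (k * r) ≤ m ∧ Real.log n ≤ K ∧
      ((N : ℝ) / r) ^ d ≤ η * n := by
  set l := Real.log n with hl
  have hd0 : 0 < d := by linarith
  have hn1 : (1:ℝ) ≤ n := by exact_mod_cast hn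
  have hn0 : (0:ℝ) < n := by linarith
  have hk0 : (0:ℝ) < k := by exact_mod_cast hk
  have hl0 : 0 < l := by linarith
  set K := ⌈l⌉₊ with hK
  have hK1 : l ≤ K := Nat.le_ceil l
  have hK2 : (K:ℝ) ≤ 2 * l := by
    have := Nat.ceil_lt_add_one hl0.le
    linarith
  have hKpos : 0 < K := Nat.ceil_pos.2 hl0
  have hK0 : (0:ℝ) < K := by exact_mod_cast hKpos
  set Z := (n : ℝ) ^ (2 - 1 / d) with hZ
  have hZ1 : 1 ≤ Z := by
    apply Real.one_le_rpow hn1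
    have : 1 / d ≤ 2 := by rw [div_le_iff₀ hd0]; linarith
    linarith
  set q : ℝ := (m : ℝ) / (K * k) with hq
  have hqlow : Z * l / (2 * k) ≤ q := by
    rw [hq, div_le_div_iff₀ (by positivity) (by positivity)]
    calc Z * l * (K * k) ≤ Z * l * (2 * l * k) := by gcongr
      _ = (Z * l ^ 2) * (2 * k) := by ring
      _ ≤ m * (2 * k) := by gcongr
  have hq1 : 1 ≤ q := by
    refine le_trans ?_ hqlow
    rw [le_div_iff₀ (by positivity)]
    nlinarith
  set r := m / (K * k) with hr
  have hKk : 0 < K * k := Nat.mul_pos hKpos hk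
  have hrq : r = ⌊q⌋₊ := by
    rw [hq, hr, ← Nat.floor_div_eq_div (K := ℝ)]
    push_cast; rfl
  have hrpos : 0 < r := by
    rw [hrq]; exact Nat.floor_pos.2 hq1
  have hr0 : (0:ℝ) < r := by exact_mod_cast hrpos
  have hrlow : q / 2 ≤ r := by
    have h1 : q < r + 1 := by rw [hrq]; exact Nat.lt_floor_add_one q
    have h2 : (1:ℝ) ≤ r := by exact_mod_cast hrpos
    linarith
  refine ⟨r, K, hrpos, (Nat.div_le_self _ _).trans hmN, ?_, hK1, ?_⟩
  · rw [← mul_assoc]; exact Nat.mul_div_le _ _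
  · have hNr : (N:ℝ) ≤ n ^ 2 := by exact_mod_cast hN
    have hZn : Z * (n:ℝ) ^ (1 / d) = n ^ 2 := by
      rw [hZ, ← Real.rpow_add hn0]
      norm_num
    have hηd : 0 < η ^ (1 / d) := Real.rpow_pos_of_pos hη _
    have hnd : 0 < (n:ℝ) ^ (1 / d) := Real.rpow_pos_of_pos hn0 _
    have hrl : Z * l / (4 * k) ≤ r := by
      refine le_trans (le_of_eq ?_) ((div_le_div_of_nonneg_right hqlow zero_le_two).trans hrlow)
      field_simp; norm_num
    have hmain : (N:ℝ) / r ≤ η ^ (1 / d) * (n:ℝ) ^ (1 / d) := by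
      rw [div_le_iff₀ hr0]
      refine hNr.trans ?_
      rw [← hZn]
      rw [div_le_iff₀ hηd] at hl3
      calc Z * (n:ℝ) ^ (1 / d) = (Z / (4 * k)) * (4 * k) * (n:ℝ) ^ (1 / d) := by field_simp
        _ ≤ (Z / (4 * k)) * (l * η ^ (1 / d)) * (n:ℝ) ^ (1 / d) := by gcongr
        _ = η ^ (1 / d) * (n:ℝ) ^ (1 / d) * (Z * l / (4 * k)) := by ring
        _ ≤ _ := by gcongr
    calc ((N:ℝ) / r) ^ d ≤ (η ^ (1 / d) * (n:ℝ) ^ (1 / d)) ^ d := by gcongr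
      _ = η * n := by
        rw [← Real.mul_rpow hη.le hn0.le, ← Real.rpow_mul (by positivity)]
        rw [one_div_mul_cancel hd0.ne', Real.rpow_one]

end Aux4

/-- **Coupling the truncated and full inverted processes** (Lemma 3.2 of Warnke).
For a 2-balanced graph `H` and `m = ⌈n^{2-1/d₂(H)} (log n)²⌉`, under the natural
coupling (using the same uniformly random edge ordering for both processes), with
probability at least `1 - n^{-c}` the graph `G_{n,m}(H)` obtained after traversing only
the first `m` edges already equals the final graph
`G_{n,\binom{n}{2}}(H) = G_{n,1}(H)` of the full process. -/
theorem inverted_process_coupling {β : Type*} [Fintype β] (H : SimpleGraph β)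
    (hH : TwoBalanced H) :
    ∀ c : ℝ, 0 < c → ∃ n₀ : ℕ, ∀ n ≥ n₀,
      ENNReal.ofReal (1 - (n : ℝ) ^ (-c)) ≤
        prOf (ordPMF n)
          {ord | keptEdges H n (⌈(n : ℝ) ^ (2 - 1 / d2 H) * Real.log n ^ 2⌉₊) ord =
            keptEdges H n (Fintype.card (EdgeType n)) ord} := by
  classical
  intro c hc
  obtain ⟨a, b, hab⟩ : ∃ a b, H.Adj a b := by
    have h2 := hH.1
    have hne : H.edgeSet.Nonempty := by
      by_contra h
      rw [Set.not_nonempty_iff_eq_empty] at h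
      rw [h] at h2
      simp at h2
    obtain ⟨f, hf⟩ := hne
    induction f with
    | _ u w => exact ⟨u, w, hf⟩
  have hd := half_le_d2 hH hab
  have hk := tau_pos hH hab
  have hCpos : 0 < bigC H a b := by
    have : 0 < Fintype.card β := Fintype.card_pos_iff.2 ⟨a⟩
    unfold bigC
    positivity
  set k := Fintype.card (RootTau H a b) with hkd
  set C := bigC H a b with hC
  set η : ℝ := min 1 (Real.exp (-(c + 2)) / C) with hη
  have hη1 : η ≤ 1 := min_le_left _ _
  have hη0 : 0 < η := lt_min one_pos (by positivity)
  have hCη : C * η ≤ Real.exp (-(c + 2)) := by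
    calc C * η ≤ C * (Real.exp (-(c + 2)) / C) := by gcongr; exact min_le_right _ _
      _ = _ := by field_simp
  have hlog : Filter.Tendsto (fun n : ℕ => Real.log n) Filter.atTop Filter.atTop :=
    Real.tendsto_log_atTop.comp tendsto_natCast_atTop_atTop
  have hev := (hlog.eventually_ge_atTop 1).and ((hlog.eventually_ge_atTop (2 * k)).and
    ((hlog.eventually_ge_atTop (4 * k / η ^ (1 / d2 H))).and
      (Filter.eventually_ge_atTop (2 * Fintype.card β + 1))))
  obtain ⟨n₀, hn₀⟩ := Filter.eventually_atTop.1 hev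
  refine ⟨n₀, fun n hn => ?_⟩
  obtain ⟨hl1, hl2, hl3, hnv⟩ := hn₀ n hn
  set m := ⌈(n : ℝ) ^ (2 - 1 / d2 H) * Real.log n ^ 2⌉₊ with hm
  have hmle : (n : ℝ) ^ (2 - 1 / d2 H) * Real.log n ^ 2 ≤ m := Nat.le_ceil _
  have hne : Nonempty (EdgeOrder n) := ⟨Fintype.equivFin _⟩
  have hn1 : 1 ≤ n := by omega
  have hn0 : (0:ℝ) < n := by exact_mod_cast hn1
  refine final_count _ _ ?_
  by_cases hmN : m ≤ Fintype.card (EdgeType n)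
  swap
  · have : ∀ ord : EdgeOrder n, keptEdges H n m ord = keptEdges H n (Fintype.card (EdgeType n)) ord := by
      intro ord
      unfold keptEdges
      ext e₀
      constructor
      · rintro ⟨e, h1, -, h2⟩
        exact ⟨e, h1, (ord e).2, h2⟩
      · rintro ⟨e, h1, -, h2⟩
        exact ⟨e, h1, (ord e).2.trans (not_le.1 hmN), h2⟩
    rw [Finset.filter_false_of_mem (fun o _ => by simpa using this o)]
    simp only [Finset.card_empty, Nat.cast_zero]
    positivity
  obtain ⟨r, K, hr, hrN, hKm, hKl, hL⟩ := numerics n k m (Fintype.card (EdgeType n)) (d2 H) η hd hk hη0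
    hn1 (card_edge_le n) hl1 hl2 hl3 hmle hmN
  have hE := fun e : EdgeType n => edge_bound hH hab e (by omega) η hη1 r K m hr hmN hrN hKm hL
  have hsub : (Finset.univ.filter fun o : EdgeOrder n => o ∉
      {ord | keptEdges H n m ord = keptEdges H n (Fintype.card (EdgeType n)) ord}) ⊆
      Finset.univ.biUnion (fun e : EdgeType n => Finset.univ.filter (fun o : EdgeOrder n =>
      ¬ copyAt H (insert e.1 (Set.image Subtype.val {g : EdgeType n | (o g : ℕ) < m})) e.1)) := by
    intro o ho
    rw [Finset.mem_filter] at ho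
    have ho := ho.2
    by_contra hcon
    simp only [Finset.mem_biUnion, Finset.mem_univ, true_and, Finset.mem_filter, not_exists,
      not_not] at hcon
    apply ho
    change keptEdges H n m o = keptEdges H n (Fintype.card (EdgeType n)) o
    unfold keptEdges
    ext e₀
    constructor
    · rintro ⟨e, h1, -, h2⟩
      exact ⟨e, h1, (o e).2, h2⟩
    · rintro ⟨e, h1, -, h2⟩
      refine ⟨e, h1, ?_, h2⟩
      by_contra hlt
      apply h2
      obtain ⟨φ, hφ, hφ2⟩ := hcon e
      refine ⟨φ, fun u w huw => ?_, hφ2⟩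
      rcases hφ u w huw with h | ⟨g, hg, h⟩
      · exact ⟨e, h, le_rfl⟩
      · refine ⟨g, h.symm, ?_⟩
        have hg : (o g : ℕ) < m := hg
        rw [Fin.le_def]
        omega
  have hM : (0:ℝ) ≤ Fintype.card (EdgeOrder n) := Nat.cast_nonneg _
  have hpow : (C * η) ^ K ≤ (n:ℝ) ^ (-(c + 2)) := by
    calc (C * η) ^ K ≤ Real.exp (-(c + 2)) ^ K := by gcongr
      _ = Real.exp (-(c + 2) * K) := by rw [← Real.exp_nat_mul]; ring_nf
      _ ≤ Real.exp (-(c + 2) * Real.log n) := by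
          apply Real.exp_le_exp.2
          nlinarith
      _ = (n:ℝ) ^ (-(c + 2)) := by rw [Real.rpow_def_of_pos hn0]; ring_nf
  have h1 := (Finset.card_le_card hsub).trans Finset.card_biUnion_le
  have h2 := (Nat.cast_le (α := ℝ)).2 h1
  rw [Nat.cast_sum] at h2
  have h3 := h2.trans (Finset.sum_le_sum fun e _ => hE e)
  rw [Finset.sum_const, nsmul_eq_mul, Finset.card_univ] at h3
  have hNn : (Fintype.card (EdgeType n) : ℝ) ≤ (n:ℝ) ^ 2 := by exact_mod_cast card_edge_le n
  refine le_trans (le_of_eq ?_) (h3.trans ?_)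
  · congr!
  · have hx : (n:ℝ) ^ 2 * (n:ℝ) ^ (-(c + 2)) = (n:ℝ) ^ (-c) := by
      rw [← Real.rpow_natCast, ← Real.rpow_add hn0]
      congr 1
      push_cast
      ring
    calc _ ≤ (n:ℝ) ^ 2 * ((Fintype.card (EdgeOrder n) : ℝ) * (n:ℝ) ^ (-(c + 2))) := by
          refine mul_le_mul hNn (mul_le_mul_of_nonneg_left hpow hM) ?_ (by positivity)
          exact mul_nonneg hM (pow_nonneg (mul_nonneg hCpos.le hη0.le) _)
      _ = (Fintype.card (EdgeOrder n) : ℝ) * ((n:ℝ) ^ 2 * (n:ℝ) ^ (-(c + 2))) := by ring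
      _ = _ := by rw [hx]
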